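/- arXiv:1702.05473 — 5 statements merged into one kernel-verified Lean document; each statement's English description precedes it below -/
import Mathlib

section
/- Gilbert–Welch construction W1(p, φ, c): Let p > 2 be prime, let φ be a primitive element of the finite field F_p, and let c be an integer. Then the (p−1)×(p−1) array (s_{i,j}) given by s_{i,j} = I[φ^{j+c} = i], where i, j range over {1, 2, …, p−1} and on the right-hand side i is interpreted as its residue in F_p, is an order p−1 Costas array. -/
/-- An order `n` permutation array: an `n × n` array with entries in `{0,1}`,
indexed by `{1, …, n}`, such that every row and every column contains exactly one `1`. -/
def IsPermArray (n : ℕ) (s : ℕ → ℕ → ℕ) : Prop :=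
  (∀ i ∈ Finset.Icc 1 n, ∀ j ∈ Finset.Icc 1 n, s i j = 0 ∨ s i j = 1) ∧
  (∀ i ∈ Finset.Icc 1 n, ∑ j ∈ Finset.Icc 1 n, s i j = 1) ∧
  (∀ j ∈ Finset.Icc 1 n, ∑ i ∈ Finset.Icc 1 n, s i j = 1)

/-- An order `n` Costas array: a permutation array in which the vectors joining
pairs of `1` entries are all distinct. -/
def IsCostasArray (n : ℕ) (s : ℕ → ℕ → ℕ) : Prop :=
  IsPermArray n s ∧
  ∀ i1 ∈ Finset.Icc 1 n, ∀ j1 ∈ Finset.Icc 1 n,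
  ∀ i2 ∈ Finset.Icc 1 n, ∀ j2 ∈ Finset.Icc 1 n,
  ∀ i3 ∈ Finset.Icc 1 n, ∀ j3 ∈ Finset.Icc 1 n,
  ∀ i4 ∈ Finset.Icc 1 n, ∀ j4 ∈ Finset.Icc 1 n,
    s i1 j1 = 1 → s i2 j2 = 1 → s i3 j3 = 1 → s i4 j4 = 1 →
    ((i2 : ℤ) - (i1 : ℤ), (j2 : ℤ) - (j1 : ℤ)) =
      ((i4 : ℤ) - (i3 : ℤ), (j4 : ℤ) - (j3 : ℤ)) →
    ((i2 : ℤ) - (i1 : ℤ), (j2 : ℤ) - (j1 : ℤ)) ≠ (0, 0) →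
    (i1, j1) = (i3, j3)

/-- A primitive element of a finite field: a generator of its multiplicative group. -/
def IsPrimitiveElt {F : Type*} [Field F] [Fintype F] (φ : F) : Prop :=
  orderOf φ = Fintype.card F - 1

theorem IsPrimitiveElt.ne_zero {F : Type*} [Field F] [Fintype F] {φ : F}
    (hφ : IsPrimitiveElt φ) : φ ≠ 0 := by
  rintro rfl
  have h : orderOf (0 : F) = Fintype.card F - 1 := hφ
  have hcard := Fintype.one_lt_card (α := F)
  rw [orderOf_zero] at h
  omega

/-- Powers of a primitive element with exponents in a shifted window of length `q - 1` are
distinct. -/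
theorem IsPrimitiveElt.zpow_add_injOn {F : Type*} [Field F] [Fintype F] {φ : F}
    (hφ : IsPrimitiveElt φ) (c : ℤ) :
    Set.InjOn (fun j : ℕ => φ ^ ((j : ℤ) + c)) (Finset.Icc 1 (Fintype.card F - 1)) := by
  intro j hj k hk hjk
  simp only [Finset.coe_Icc, Set.mem_Icc] at hj hk
  simp only [zpow_add₀ hφ.ne_zero, zpow_natCast] at hjk
  have hpow : φ ^ j = φ ^ k := mul_right_cancel₀ (zpow_ne_zero c hφ.ne_zero) hjk
  have hunit : (Units.mk0 φ hφ.ne_zero) ^ j = (Units.mk0 φ hφ.ne_zero) ^ k :=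
    Units.ext (by simpa using hpow)
  have hord : orderOf (Units.mk0 φ hφ.ne_zero) = Fintype.card F - 1 := by
    rw [← orderOf_units]
    exact hφ
  rw [pow_eq_pow_iff_modEq, hord] at hunit
  have habs : |(k : ℤ) - j| < (Fintype.card F - 1 : ℕ) := by
    rw [abs_lt]
    omega
  exact Nat.ModEq.eq_of_abs_lt hunit habs

theorem ZMod.natCast_injOn_Icc (p : ℕ) [NeZero p] :
    Set.InjOn (fun i : ℕ => (i : ZMod p)) (Finset.Icc 1 (p - 1)) := by
  intro i hi k hk hik
  simp only [Finset.coe_Icc, Set.mem_Icc] at hi hk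
  have h := (ZMod.natCast_eq_natCast_iff' i k p).mp hik
  rwa [Nat.mod_eq_of_lt (by omega), Nat.mod_eq_of_lt (by omega)] at h

theorem ZMod.val_mem_Icc {p : ℕ} [NeZero p] {x : ZMod p} (hx : x ≠ 0) :
    x.val ∈ Finset.Icc 1 (p - 1) := by
  have hlt := x.val_lt
  have hpos := (ZMod.val_pos (a := x)).mpr hx
  rw [Finset.mem_Icc]
  omega

/-- Gilbert–Welch construction `W₁(p, φ, c)`: for a prime `p > 2`, a primitive element
`φ` of `𝔽_p` and an integer `c`, the array `s i j = I[φ^(j+c) = i]` for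
`i, j ∈ {1, …, p−1}` is an order `p − 1` Costas array. -/
theorem gilbert_welch_W1 (p : ℕ) [Fact p.Prime] (hp : 2 < p) (φ : ZMod p)
    (hφ : IsPrimitiveElt φ) (c : ℤ) :
    IsCostasArray (p - 1)
      (fun i j => if φ ^ ((j : ℤ) + c) = (i : ZMod p) then 1 else 0) := by
  have hφ0 : φ ≠ 0 := hφ.ne_zero
  have hzpow : Set.InjOn (fun j : ℕ => φ ^ ((j : ℤ) + c)) (Finset.Icc 1 (p - 1)) := by
    simpa only [ZMod.card] using hφ.zpow_add_injOn c
  have hcast := ZMod.natCast_injOn_Icc p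
  have hmem (j : ℕ) : (φ ^ ((j : ℤ) + c)).val ∈ Finset.Icc 1 (p - 1) :=
    ZMod.val_mem_Icc (zpow_ne_zero _ hφ0)
  refine ⟨⟨fun i _ j _ => ?_, fun i hi => ?_, fun j hj => ?_⟩, ?_⟩
  · dsimp only
    split_ifs <;> simp
  · obtain ⟨j, hj, hji⟩ := Finset.surjOn_of_injOn_of_card_le
      (s := Finset.Icc 1 (p - 1)) (t := Finset.Icc 1 (p - 1))
      (fun j : ℕ => (φ ^ ((j : ℤ) + c)).val) (fun j _ => hmem j)
      (fun j hj k hk h => hzpow hj hk (ZMod.val_injective p h)) le_rfl hi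
    have hj1 : φ ^ ((j : ℤ) + c) = (i : ZMod p) := by
      rw [← hji, ZMod.natCast_zmod_val]
    rw [Finset.sum_eq_single_of_mem j hj]
    · exact if_pos hj1
    intro k hk hkj
    exact if_neg fun h => hkj (hzpow hk hj (h.trans hj1.symm))
  · have hval := ZMod.natCast_zmod_val (φ ^ ((j : ℤ) + c))
    rw [Finset.sum_eq_single_of_mem _ (hmem j)]
    · exact if_pos hval.symm
    intro i hi hij
    exact if_neg fun h => hij (hcast hi (hmem j) (h.symm.trans hval.symm))
  · intro i1 hi1 j1 hj1 i2 hi2 j2 hj2 i3 hi3 j3 hj3 i4 _ j4 _ h1 h2 h3 h4 heq hne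
    simp only [ite_eq_left_iff, zero_ne_one, imp_false, not_not] at h1 h2 h3 h4
    rw [Prod.mk.injEq] at heq
    obtain ⟨hi, hj⟩ := heq
    have hdiff : (i2 : ZMod p) - i1 = i4 - i3 := by
      exact_mod_cast congrArg (Int.cast : ℤ → ZMod p) hi
    have e2 : (j2 : ℤ) + c = (j1 + c) + (j2 - j1) := by ring
    have e4 : (j4 : ℤ) + c = (j3 + c) + (j2 - j1) := by rw [hj]; ring
    have h2' := h2
    rw [e2, zpow_add₀ hφ0, h1] at h2'
    rw [e4, zpow_add₀ hφ0, h3] at h4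
    have hmul : (i1 : ZMod p) * (φ ^ ((j2 : ℤ) - j1) - 1) =
        i3 * (φ ^ ((j2 : ℤ) - j1) - 1) := by
      linear_combination hdiff + h2' - h4
    have hd : φ ^ ((j2 : ℤ) - j1) - 1 ≠ 0 := by
      intro hd
      rw [sub_eq_zero.mp hd, mul_one] at h2'
      have hii : i1 = i2 := hcast hi1 hi2 h2'
      have hjj : j1 = j2 := hzpow hj1 hj2 (h1.trans (h2'.trans h2.symm))
      exact hne (by simp [hii, hjj])
    have h13 := mul_right_cancel₀ hd hmul
    exact Prod.ext (hcast hi1 hi3 h13) (hzpow hj1 hj3 (h1.trans (h13.trans h3.symm)))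
end

section
/- Golomb construction G2(q, φ, ρ): Let q > 3 be a prime power, and let φ and ρ be (not necessarily distinct) primitive elements of the finite field F_q. Then the (q−2)×(q−2) array (s_{i,j}) given by s_{i,j} = I[φ^i + ρ^j = 1] for i, j ∈ {1, 2, …, q−2}, where the equation is over F_q, is an order q−2 Costas array. -/
namespace IsPrimitiveElt

variable {F : Type*} [Field F] [Fintype F] {φ : F}

theorem ne_zero_s1 (hφ : IsPrimitiveElt φ) : φ ≠ 0 := by
  rintro rfl
  have h := Fintype.one_lt_card (α := F)
  simp only [IsPrimitiveElt, orderOf_zero] at hφ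
  omega

theorem pow_inj (hφ : IsPrimitiveElt φ) {i j : ℕ}
    (hi : i ∈ Finset.Icc 1 (Fintype.card F - 2)) (hj : j ∈ Finset.Icc 1 (Fintype.card F - 2))
    (h : φ ^ i = φ ^ j) : i = j := by
  rw [Finset.mem_Icc] at hi hj
  refine pow_injOn_Iio_orderOf ?_ ?_ h <;> rw [Set.mem_Iio, hφ] <;> omega

theorem pow_ne_one (hφ : IsPrimitiveElt φ) {i : ℕ}
    (hi : i ∈ Finset.Icc 1 (Fintype.card F - 2)) : φ ^ i ≠ 1 := by
  rw [Finset.mem_Icc] at hi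
  refine pow_ne_one_of_lt_orderOf (by omega) ?_
  rw [hφ]
  omega

theorem exists_pow_eq (hφ : IsPrimitiveElt φ) {x : F} (h0 : x ≠ 0) (h1 : x ≠ 1) :
    ∃ i ∈ Finset.Icc 1 (Fintype.card F - 2), φ ^ i = x := by
  have hcard := Fintype.one_lt_card (α := F)
  have hroot : IsPrimitiveRoot φ (Fintype.card F - 1) := hφ ▸ IsPrimitiveRoot.orderOf φ
  have : NeZero (Fintype.card F - 1) := ⟨by omega⟩
  obtain ⟨i, hi, rfl⟩ := hroot.eq_pow_of_pow_eq_one (FiniteField.pow_card_sub_one_eq_one x h0)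
  have hi0 : i ≠ 0 := by
    rintro rfl
    exact h1 (pow_zero φ)
  exact ⟨i, Finset.mem_Icc.mpr ⟨by omega, by omega⟩, rfl⟩

/-- Each nonzero `x ≠ 1` is a unique power of a primitive element with exponent in
`{1, …, q - 2}`, so the indicator of that power sums to `1`. -/
theorem sum_indicator [DecidableEq F] (hφ : IsPrimitiveElt φ) {x : F} (h0 : x ≠ 0) (h1 : x ≠ 1) :
    ∑ i ∈ Finset.Icc 1 (Fintype.card F - 2), (if φ ^ i = x then 1 else 0) = 1 := by
  obtain ⟨i, hi, rfl⟩ := hφ.exists_pow_eq h0 h1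
  rw [Finset.sum_eq_single_of_mem i hi, if_pos rfl]
  intro j hj hji
  exact if_neg fun h => hji (hφ.pow_inj hj hi h)

end IsPrimitiveElt

/-- If `(a₂, a₃)` and `(a₁, a₄)` have equal products, and so do their complements to `1`,
then the two pairs agree up to order. -/
theorem eq_or_eq_of_mul_eq_mul {R : Type*} [CommRing R] [IsDomain R]
    {a₁ b₁ a₂ b₂ a₃ b₃ a₄ b₄ : R}
    (h₁ : a₁ + b₁ = 1) (h₂ : a₂ + b₂ = 1) (h₃ : a₃ + b₃ = 1) (h₄ : a₄ + b₄ = 1)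
    (ha : a₂ * a₃ = a₁ * a₄) (hb : b₂ * b₃ = b₁ * b₄) :
    (a₂ = a₁ ∧ b₂ = b₁) ∨ (a₁ = a₃ ∧ b₁ = b₃) := by
  obtain rfl := eq_sub_of_add_eq' h₁
  obtain rfl := eq_sub_of_add_eq' h₂
  obtain rfl := eq_sub_of_add_eq' h₃
  obtain rfl := eq_sub_of_add_eq' h₄
  have hsum : a₂ + a₃ = a₁ + a₄ := by linear_combination ha - hb
  have hprod : (a₂ - a₁) * (a₁ - a₃) = 0 := by linear_combination a₁ * hsum - ha
  rcases mul_eq_zero.mp hprod with h | h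
  · exact .inl ⟨sub_eq_zero.mp h, by rw [sub_eq_zero.mp h]⟩
  · exact .inr ⟨sub_eq_zero.mp h, by rw [sub_eq_zero.mp h]⟩

/-- Golomb construction `G₂(q, φ, ρ)`: for a prime power `q > 3` and primitive elements
`φ, ρ` of `𝔽_q`, the array `s i j = I[φ^i + ρ^j = 1]` for `i, j ∈ {1, …, q−2}`
is an order `q − 2` Costas array. -/
theorem golomb_G2 (q : ℕ) (hq : 3 < q) (F : Type*) [Field F] [Fintype F] [DecidableEq F]
    (hcard : Fintype.card F = q) (φ ρ : F)
    (hφ : IsPrimitiveElt φ) (hρ : IsPrimitiveElt ρ) :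
    IsCostasArray (q - 2)
      (fun i j => if φ ^ i + ρ ^ j = 1 then 1 else 0) := by
  subst hcard
  refine ⟨⟨fun i _ j _ => ?_, fun i hi => ?_, fun j hj => ?_⟩, ?_⟩
  · dsimp only
    split_ifs <;> simp
  · have hx0 : 1 - φ ^ i ≠ 0 := sub_ne_zero.mpr (hφ.pow_ne_one hi).symm
    have hx1 : 1 - φ ^ i ≠ 1 := fun h => pow_ne_zero i hφ.ne_zero_s1 (sub_eq_self.mp h)
    simpa only [eq_sub_iff_add_eq'] using hρ.sum_indicator hx0 hx1
  · have hx0 : 1 - ρ ^ j ≠ 0 := sub_ne_zero.mpr (hρ.pow_ne_one hj).symm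
    have hx1 : 1 - ρ ^ j ≠ 1 := fun h => pow_ne_zero j hρ.ne_zero_s1 (sub_eq_self.mp h)
    simpa only [eq_sub_iff_add_eq] using hφ.sum_indicator hx0 hx1
  · intro i1 hi1 j1 hj1 i2 hi2 j2 hj2 i3 hi3 j3 hj3 i4 hi4 j4 hj4 h1 h2 h3 h4 heq hne
    simp only [ite_eq_left_iff, zero_ne_one, imp_false, not_not] at h1 h2 h3 h4
    rw [Prod.mk.injEq] at heq
    have hi : i2 + i3 = i1 + i4 := by omega
    have hj : j2 + j3 = j1 + j4 := by omega
    have ha : φ ^ i2 * φ ^ i3 = φ ^ i1 * φ ^ i4 := by rw [← pow_add, ← pow_add, hi]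
    have hb : ρ ^ j2 * ρ ^ j3 = ρ ^ j1 * ρ ^ j4 := by rw [← pow_add, ← pow_add, hj]
    rcases eq_or_eq_of_mul_eq_mul h1 h2 h3 h4 ha hb with ⟨hl, hr⟩ | ⟨hl, hr⟩
    · refine absurd ?_ hne
      rw [hφ.pow_inj hi2 hi1 hl, hρ.pow_inj hj2 hj1 hr, sub_self, sub_self]
    · rw [hφ.pow_inj hi1 hi3 hl, hρ.pow_inj hj1 hj3 hr]
end

section
/- Theorem (second Costas cube family): Let p > 3 be prime, and let φ, ψ be (not necessarily distinct) primitive elements of the finite field F_p. Then the (p−2)×(p−2)×(p−2) array D = (d_{i,j,k}) given by d_{i,j,k} = I[i = φ^j − 1 = −ψ^k] for i, j, k ∈ {1, 2, …, p−2}, where the equations are over F_p (with i interpreted as its residue in F_p), is an order p−2 Costas cube; moreover Projection A of D is the array (I[i = φ^j − 1]) (the W2(p, φ) Gilbert–Welch Costas array), Projection B of D is the array (I[i = −ψ^k]) (which is the reflection through a vertical axis of the W2(p, ψ) Gilbert–Welch Costas array), and Projection C of D is the array (I[φ^j + ψ^k = 1]) (the G2(p, φ, ψ) Golomb Costas array).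 -/
/-- Projection A of a three-dimensional array: `a i j = ∑ k, d i j k`. -/
def ProjA (n : ℕ) (d : ℕ → ℕ → ℕ → ℕ) (i j : ℕ) : ℕ := ∑ k ∈ Finset.Icc 1 n, d i j k

/-- Projection B of a three-dimensional array: `b i k = ∑ j, d i j k`. -/
def ProjB (n : ℕ) (d : ℕ → ℕ → ℕ → ℕ) (i k : ℕ) : ℕ := ∑ j ∈ Finset.Icc 1 n, d i j k

/-- Projection C of a three-dimensional array: `c j k = ∑ i, d i j k`. -/
def ProjC (n : ℕ) (d : ℕ → ℕ → ℕ → ℕ) (j k : ℕ) : ℕ := ∑ i ∈ Finset.Icc 1 n, d i j k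

/-- An order `n` Costas cube: an `n × n × n` array over `ℤ₂` whose three
projections are each order `n` Costas arrays. -/
def IsCostasCube (n : ℕ) (d : ℕ → ℕ → ℕ → ℕ) : Prop :=
  (∀ i ∈ Finset.Icc 1 n, ∀ j ∈ Finset.Icc 1 n, ∀ k ∈ Finset.Icc 1 n,
      d i j k = 0 ∨ d i j k = 1) ∧
  IsCostasArray n (ProjA n d) ∧ IsCostasArray n (ProjB n d) ∧ IsCostasArray n (ProjC n d)

theorem sum_indicator_eq_one {F : Type*} [DecidableEq F] {n : ℕ} {u : ℕ → F} {S : Finset F}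
    (hu : Set.BijOn u (Finset.Icc 1 n : Finset ℕ) S) {x : F} (hx : x ∈ S) :
    ∑ i ∈ Finset.Icc 1 n, (if x = u i then 1 else 0) = 1 := by
  obtain ⟨i, hi, rfl⟩ := hu.surjOn hx
  rw [Finset.sum_eq_single_of_mem i hi fun j hj hji => if_neg fun h => hji (hu.injOn hj hi h.symm),
    if_pos rfl]

theorem sum_indicator_and {F : Type*} [DecidableEq F] {n : ℕ} {w : ℕ → F} {S : Finset F}
    (hw : Set.BijOn w (Finset.Icc 1 n : Finset ℕ) S) {x : F} (hx : x ∈ S) (P : Prop) [Decidable P] :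
    ∑ k ∈ Finset.Icc 1 n, (if P ∧ x = w k then 1 else 0) = if P then 1 else 0 := by
  by_cases hP : P
  · simpa [hP] using sum_indicator_eq_one hw hx
  · simp [hP]

/-- If two parametrizations of the same finite set turn every parallelogram of matched indices into
a quadruple with equal sums and equal products, their incidence array is Costas. -/
theorem isCostasArray_of_bijOn {F : Type*} [Field F] [DecidableEq F] {n : ℕ} {u v : ℕ → F}
    {S : Finset F} {s : ℕ → ℕ → ℕ}
    (hu : Set.BijOn u (Finset.Icc 1 n : Finset ℕ) S)
    (hv : Set.BijOn v (Finset.Icc 1 n : Finset ℕ) S)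
    (hs : ∀ i ∈ Finset.Icc 1 n, ∀ j ∈ Finset.Icc 1 n, s i j = if u i = v j then 1 else 0)
    (H : ∀ i₁ j₁ i₂ j₂ i₃ j₃ i₄ j₄ : ℕ, u i₁ = v j₁ → u i₂ = v j₂ → u i₃ = v j₃ → u i₄ = v j₄ →
      i₂ + i₃ = i₁ + i₄ → j₂ + j₃ = j₁ + j₄ →
      u i₂ + u i₃ = u i₁ + u i₄ ∧ u i₂ * u i₃ = u i₁ * u i₄) :
    IsCostasArray n s := by
  refine ⟨⟨fun i hi j hj => ?_, fun i hi => ?_, fun j hj => ?_⟩, ?_⟩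
  · rw [hs i hi j hj]
    split_ifs <;> simp
  · rw [Finset.sum_congr rfl fun j hj => hs i hi j hj]
    exact sum_indicator_eq_one hv (hu.mapsTo hi)
  · rw [Finset.sum_congr rfl fun i hi => (hs i hi j hj).trans (if_congr eq_comm rfl rfl)]
    exact sum_indicator_eq_one hu (hv.mapsTo hj)
  · intro i₁ hi₁ j₁ hj₁ i₂ hi₂ j₂ hj₂ i₃ hi₃ j₃ hj₃ i₄ hi₄ j₄ hj₄ h₁ h₂ h₃ h₄ heq hne
    have huv : ∀ i ∈ Finset.Icc 1 n, ∀ j ∈ Finset.Icc 1 n, s i j = 1 → u i = v j := by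
      intro i hi j hj h
      rw [hs i hi j hj] at h
      by_contra hij
      simp [hij] at h
    replace h₁ := huv _ hi₁ _ hj₁ h₁
    replace h₂ := huv _ hi₂ _ hj₂ h₂
    replace h₃ := huv _ hi₃ _ hj₃ h₃
    replace h₄ := huv _ hi₄ _ hj₄ h₄
    have hij {i j i' j' : ℕ} (hi : i ∈ Finset.Icc 1 n) (hj : j ∈ Finset.Icc 1 n)
        (hi' : i' ∈ Finset.Icc 1 n) (hj' : j' ∈ Finset.Icc 1 n) (h : u i = v j)
        (h' : u i' = v j') (e : u i = u i') : i = i' ∧ j = j' :=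
      ⟨hu.injOn hi hi' e, hv.injOn hj hj' (h.symm.trans (e.trans h'))⟩
    simp only [Prod.mk.injEq] at heq
    obtain ⟨hsum, hprod⟩ := H i₁ j₁ i₂ j₂ i₃ j₃ i₄ j₄ h₁ h₂ h₃ h₄ (by omega) (by omega)
    have hfac : (u i₁ - u i₃) * (u i₃ - u i₄) = 0 := by
      linear_combination hprod - u i₃ * hsum
    rcases mul_eq_zero.mp hfac with h | h
    · obtain ⟨rfl, rfl⟩ := hij hi₁ hj₁ hi₃ hj₃ h₁ h₃ (sub_eq_zero.mp h)
      rfl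
    · obtain ⟨rfl, rfl⟩ := hij hi₃ hj₃ hi₄ hj₄ h₃ h₄ (sub_eq_zero.mp h)
      exact absurd (by simp [heq]) hne

theorem bijOn_compl_zero_one {F : Type*} [Field F] [Fintype F] [DecidableEq F] {u : ℕ → F}
    (hinj : Set.InjOn u (Finset.Icc 1 (Fintype.card F - 2) : Finset ℕ))
    (hne : ∀ j ∈ Finset.Icc 1 (Fintype.card F - 2), u j ≠ 0 ∧ u j ≠ 1) :
    Set.BijOn u (Finset.Icc 1 (Fintype.card F - 2) : Finset ℕ) (({0, 1}ᶜ : Finset F)) := by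
  have hmaps : Set.MapsTo u (Finset.Icc 1 (Fintype.card F - 2) : Finset ℕ)
      (({0, 1}ᶜ : Finset F)) := fun j hj => by simpa [and_comm] using hne j hj
  refine ⟨hmaps, hinj, Finset.surjOn_of_injOn_of_card_le u hmaps hinj ?_⟩
  rw [Finset.card_compl, Finset.card_pair zero_ne_one, Nat.card_Icc]
  omega

namespace IsPrimitiveElt

variable {F : Type*} [Field F] [Fintype F] {φ : F}

theorem bijOn_pow [DecidableEq F] (hφ : IsPrimitiveElt φ) :
    Set.BijOn (fun j : ℕ => φ ^ j) (Finset.Icc 1 (Fintype.card F - 2) : Finset ℕ)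
      (({0, 1}ᶜ : Finset F)) := by
  have hord : orderOf φ = Fintype.card F - 1 := hφ
  have hcard := Fintype.one_lt_card (α := F)
  refine bijOn_compl_zero_one (pow_injOn_Iio_orderOf.mono fun j hj => ?_) fun j hj => ?_
  · simp only [Finset.coe_Icc, Set.mem_Icc] at hj
    rw [Set.mem_Iio]
    omega
  · rw [Finset.mem_Icc] at hj
    refine ⟨pow_ne_zero _ ?_, pow_ne_one_of_lt_orderOf (by omega) (by omega)⟩
    rintro rfl
    have h := pow_orderOf_eq_one (0 : F)
    rw [zero_pow (by omega)] at h
    exact zero_ne_one h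

theorem bijOn_one_sub_pow [DecidableEq F] (hφ : IsPrimitiveElt φ) :
    Set.BijOn (fun j : ℕ => 1 - φ ^ j) (Finset.Icc 1 (Fintype.card F - 2) : Finset ℕ)
      (({0, 1}ᶜ : Finset F)) := by
  refine bijOn_compl_zero_one (fun i hi j hj h => hφ.bijOn_pow.injOn hi hj (sub_right_injective h))
    fun j hj => ?_
  have h := hφ.bijOn_pow.mapsTo hj
  simp only [Finset.coe_compl, Finset.coe_pair, Set.mem_compl_iff, Set.mem_insert_iff,
    Set.mem_singleton_iff, not_or] at h
  exact ⟨fun h0 => h.2 (sub_eq_zero.mp h0).symm, fun h1 => h.1 (sub_eq_self.mp h1)⟩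

end IsPrimitiveElt

theorem ZMod.bijOn_natCast_add_one (p : ℕ) [Fact p.Prime] :
    Set.BijOn (fun i : ℕ => (i : ZMod p) + 1) (Finset.Icc 1 (p - 2) : Finset ℕ)
      (({0, 1}ᶜ : Finset (ZMod p))) := by
  have hp := (Fact.out : p.Prime).two_le
  have hinj : Set.InjOn (fun i : ℕ => (i : ZMod p)) (Set.Iio p) := fun i hi j hj h =>
    Nat.ModEq.eq_of_lt_of_lt ((ZMod.natCast_eq_natCast_iff i j p).mp h) hi hj
  have key := bijOn_compl_zero_one (F := ZMod p) (u := fun i : ℕ => (i : ZMod p) + 1)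
  rw [ZMod.card] at key
  refine key (fun i hi j hj h => ?_) fun j hj => ?_
  · simp only [Finset.coe_Icc, Set.mem_Icc] at hi hj
    exact hinj (Set.mem_Iio.mpr (by omega)) (Set.mem_Iio.mpr (by omega)) (add_right_cancel h)
  · rw [Finset.mem_Icc] at hj
    refine ⟨fun h => ?_, fun h => ?_⟩
    · have h' : ((j + 1 : ℕ) : ZMod p) = 0 := by exact_mod_cast h
      have := Nat.le_of_dvd (by omega) ((ZMod.natCast_eq_zero_iff _ _).mp h')
      omega
    · have := Nat.le_of_dvd (by omega) ((ZMod.natCast_eq_zero_iff _ _).mp (add_eq_right.mp h))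
      omega

/-- Second Costas cube family: for a prime `p > 3` and primitive elements `φ, ψ` of
`𝔽_p`, the array `d i j k = I[i = φ^j − 1 = −ψ^k]` for `i, j, k ∈ {1, …, p−2}`
is an order `p − 2` Costas cube, whose Projection A is `(I[i = φ^j − 1])`
(the `W₂(p, φ)` Gilbert–Welch Costas array), Projection B is `(I[i = −ψ^k])`
(the reflection through a vertical axis of the `W₂(p, ψ)` Gilbert–Welch Costas
array), and Projection C is `(I[φ^j + ψ^k = 1])` (the `G₂(p, φ, ψ)` Golomb
Costas array). -/
theorem second_costas_cube_family (p : ℕ) [Fact p.Prime] (hp : 3 < p) (φ ψ : ZMod p)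
    (hφ : IsPrimitiveElt φ) (hψ : IsPrimitiveElt ψ)
    (d : ℕ → ℕ → ℕ → ℕ)
    (hd : d = fun (i j k : ℕ) =>
      if (i : ZMod p) = φ ^ j - 1 ∧ (i : ZMod p) = -ψ ^ k then 1 else 0) :
    IsCostasCube (p - 2) d ∧
    (∀ i ∈ Finset.Icc 1 (p - 2), ∀ j ∈ Finset.Icc 1 (p - 2),
      ProjA (p - 2) d i j = if (i : ZMod p) = φ ^ j - 1 then 1 else 0) ∧
    (∀ i ∈ Finset.Icc 1 (p - 2), ∀ k ∈ Finset.Icc 1 (p - 2),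
      ProjB (p - 2) d i k = if (i : ZMod p) = -ψ ^ k then 1 else 0) ∧
    (∀ j ∈ Finset.Icc 1 (p - 2), ∀ k ∈ Finset.Icc 1 (p - 2),
      ProjC (p - 2) d j k = if φ ^ j + ψ ^ k = 1 then 1 else 0) := by
  have hcard := ZMod.card p
  have hu := ZMod.bijOn_natCast_add_one p
  have hv := hφ.bijOn_pow
  have hw := hψ.bijOn_one_sub_pow
  rw [hcard] at hv hw
  have eA (i j : ℕ) : (i : ZMod p) = φ ^ j - 1 ↔ (i : ZMod p) + 1 = φ ^ j := eq_sub_iff_add_eq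
  have eB (i k : ℕ) : (i : ZMod p) = -ψ ^ k ↔ (i : ZMod p) + 1 = 1 - ψ ^ k := by
    constructor <;> intro h <;> linear_combination h
  have eC (j k : ℕ) : φ ^ j + ψ ^ k = 1 ↔ φ ^ j = 1 - ψ ^ k := eq_sub_iff_add_eq.symm
  subst hd
  simp only [eA, eB, eC]
  unfold IsCostasCube
  set d : ℕ → ℕ → ℕ → ℕ := fun i j k =>
    if (i : ZMod p) + 1 = φ ^ j ∧ (i : ZMod p) + 1 = 1 - ψ ^ k then 1 else 0 with hd
  have hA : ∀ i ∈ Finset.Icc 1 (p - 2), ∀ j ∈ Finset.Icc 1 (p - 2),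
      ProjA (p - 2) d i j = if (i : ZMod p) + 1 = φ ^ j then 1 else 0 := fun i hi j _ =>
    sum_indicator_and hw (hu.mapsTo hi) _
  have hB : ∀ i ∈ Finset.Icc 1 (p - 2), ∀ k ∈ Finset.Icc 1 (p - 2),
      ProjB (p - 2) d i k = if (i : ZMod p) + 1 = 1 - ψ ^ k then 1 else 0 := fun i hi k _ =>
    (Finset.sum_congr rfl fun j _ => if_congr and_comm rfl rfl).trans
      (sum_indicator_and hv (hu.mapsTo hi) _)
  have hC : ∀ j ∈ Finset.Icc 1 (p - 2), ∀ k ∈ Finset.Icc 1 (p - 2),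
      ProjC (p - 2) d j k = if φ ^ j = 1 - ψ ^ k then 1 else 0 := fun j hj k _ =>
    (Finset.sum_congr rfl fun i _ => if_congr (by grind) rfl rfl).trans
      (sum_indicator_and hu (hv.mapsTo hj) _)
  have add {a b c e : ℕ} (h : b + c = a + e) :
      ((b : ZMod p) + 1) + (c + 1) = (a + 1) + (e + 1) := by
    have h' : (b : ZMod p) + c = a + e := by
      exact_mod_cast congrArg (Nat.cast (R := ZMod p)) h
    linear_combination h'
  have mul (x : ZMod p) {a b c e : ℕ} (h : b + c = a + e) : x ^ b * x ^ c = x ^ a * x ^ e := by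
    rw [← pow_add, ← pow_add, h]
  refine ⟨⟨fun i _ j _ k _ => ?_, isCostasArray_of_bijOn hu hv hA ?_,
    isCostasArray_of_bijOn hu hw hB ?_, isCostasArray_of_bijOn hv hw hC ?_⟩, hA, hB, hC⟩
  · simp only [hd]
    split_ifs <;> simp
  · intro i₁ j₁ i₂ j₂ i₃ j₃ i₄ j₄ h₁ h₂ h₃ h₄ hi hj
    refine ⟨add hi, ?_⟩
    simp only [h₁, h₂, h₃, h₄]
    exact mul φ hj
  · intro i₁ j₁ i₂ j₂ i₃ j₃ i₄ j₄ h₁ h₂ h₃ h₄ hi hj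
    have hsum := add hi
    refine ⟨hsum, ?_⟩
    simp only [h₁, h₂, h₃, h₄] at hsum ⊢
    linear_combination mul ψ hj + hsum
  · intro i₁ j₁ i₂ j₂ i₃ j₃ i₄ j₄ h₁ h₂ h₃ h₄ hi hj
    have hprod := mul φ hi
    refine ⟨?_, hprod⟩
    simp only [h₁, h₂, h₃, h₄] at hprod ⊢
    linear_combination hprod - mul ψ hj
end

section
/- Theorem (third Costas cube family): Let q > 3 be a prime power, and suppose there exists a primitive element φ of the finite field F_q for which both 1 − φ and 1 − φ^{−1} are also primitive. Then the (q−3)×(q−3)×(q−3) array D = (d_{i,j,k}) given by d_{i,j,k} = I[φ^{i+1} + (1−φ)^{j+1} = 1 and φ^{−(i+1)} + (1−φ^{−1})^{k+1} = 1 and (1−φ)^{−(j+1)} + (1−φ^{−1})^{−(k+1)} = 1] for i, j, k ∈ {1, 2, …, q−3}, where the equations are over F_q, is an order q−3 Costas cube; moreover Projection A of D is the G3(q, φ) Golomb Costas array (I[φ^{i+1} + (1−φ)^{j+1} = 1]), Projection B of D is the G3(q, φ^{−1}) Golomb Costas array (I[(φ^{−1})^{i+1} + (1−φ)^{−(k+1)}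 = 1]... equivalently (I[φ^{−(i+1)} + (1−φ^{−1})^{k+1} = 1])), and Projection C of D is the G3(q, (1−φ)^{−1}) Golomb Costas array (I[((1−φ)^{−1})^{j+1} + (1 − (1−φ)^{−1})^{k+1} = 1]). -/
section Primitive

variable {F : Type*} [Field F] [Fintype F]

theorem IsPrimitiveElt.ne_zero_s11 {a : F} (ha : IsPrimitiveElt a) (hF : 3 < Fintype.card F) :
    a ≠ 0 := by
  rintro rfl
  rw [IsPrimitiveElt, orderOf_zero] at ha
  omega

theorem IsPrimitiveElt.inv {a : F} (ha : IsPrimitiveElt a) : IsPrimitiveElt a⁻¹ := by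
  rw [IsPrimitiveElt, ← ha, orderOf_eq_orderOf_iff]
  intro n
  rw [inv_pow, inv_eq_one]

theorem IsPrimitiveElt.pow_inj_s11 {a : F} (ha : IsPrimitiveElt a) {m n : ℕ}
    (hm : m < Fintype.card F - 1) (hn : n < Fintype.card F - 1) (h : a ^ m = a ^ n) : m = n :=
  pow_injOn_Iio_orderOf (Set.mem_Iio.mpr (ha.symm ▸ hm)) (Set.mem_Iio.mpr (ha.symm ▸ hn)) h

theorem IsPrimitiveElt.exists_pow_eq_s11 [DecidableEq F] {a : F} (ha : IsPrimitiveElt a)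
    (hF : 3 < Fintype.card F) {x : F} (hx : x ≠ 0) :
    ∃ m < Fintype.card F - 1, a ^ m = x := by
  have himage : (Finset.range (Fintype.card F - 1)).image (a ^ ·) = Finset.univ.erase 0 := by
    apply Finset.eq_of_subset_of_card_le
    · intro y hy
      obtain ⟨m, -, rfl⟩ := Finset.mem_image.mp hy
      simp [ha.ne_zero_s11 hF]
    · rw [Finset.card_image_of_injOn, Finset.card_range,
        Finset.card_erase_of_mem (Finset.mem_univ _), Finset.card_univ]
      intro m hm n hn h
      exact ha.pow_inj_s11 (by simpa using hm) (by simpa using hn) h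
  have hmem : x ∈ (Finset.range (Fintype.card F - 1)).image (a ^ ·) := by
    rw [himage]
    simpa using hx
  simpa using hmem

/-- Row `i` of a Golomb array contains exactly one entry `1`. -/
theorem golomb_existsUnique [DecidableEq F] {a b : F} (ha : IsPrimitiveElt a)
    (hb : IsPrimitiveElt b) (hab : a + b = 1) {i : ℕ}
    (hi : i ∈ Finset.Icc 1 (Fintype.card F - 3)) :
    ∃! j, j ∈ Finset.Icc 1 (Fintype.card F - 3) ∧ a ^ (i + 1) + b ^ (j + 1) = 1 := by
  rw [Finset.mem_Icc] at hi
  have hF : 3 < Fintype.card F := by omega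
  have ha0 : a ^ (i + 1) ≠ 0 := pow_ne_zero _ (ha.ne_zero_s11 hF)
  have ha1 : a ^ (i + 1) ≠ 1 := fun h => by
    have := ha.pow_inj_s11 (m := i + 1) (n := 0) (by omega) (by omega) (by simpa using h)
    omega
  have haa : a ^ (i + 1) ≠ a := fun h => by
    have := ha.pow_inj_s11 (m := i + 1) (n := 1) (by omega) (by omega) (by simpa using h)
    omega
  obtain ⟨m, hm, hbm⟩ := hb.exists_pow_eq_s11 hF (sub_ne_zero.mpr ha1.symm)
  have hm0 : m ≠ 0 := by
    rintro rfl
    exact ha0 (by linear_combination hbm - pow_zero b)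
  have hm1 : m ≠ 1 := by
    rintro rfl
    exact haa (by linear_combination hbm - pow_one b - hab)
  refine ⟨m - 1, ⟨Finset.mem_Icc.mpr (by omega), ?_⟩, ?_⟩
  · rw [Nat.sub_add_cancel (by omega), hbm]
    ring
  · rintro j ⟨hj, hj'⟩
    rw [Finset.mem_Icc] at hj
    have := hb.pow_inj_s11 (m := j + 1) (n := m) (by omega) hm (by linear_combination hj' - hbm)
    omega

end Primitive

theorem sum_ite_existsUnique {s : Finset ℕ} (p : ℕ → Prop) [DecidablePred p]
    (h : ∃! k, k ∈ s ∧ p k) : ∑ k ∈ s, (if p k then 1 else 0) = 1 := by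
  obtain ⟨k, ⟨hk, hpk⟩, huniq⟩ := h
  rw [Finset.sum_eq_single_of_mem k hk, if_pos hpk]
  exact fun l hl hlk => if_neg fun hpl => hlk (huniq l ⟨hl, hpl⟩)

theorem sum_ite_and_existsUnique {s : Finset ℕ} (P : Prop) [Decidable P] (p : ℕ → Prop)
    [DecidablePred p] (h : ∃! k, k ∈ s ∧ p k) :
    ∑ k ∈ s, (if P ∧ p k then 1 else 0) = if P then 1 else 0 := by
  by_cases hP : P
  · simpa [hP] using sum_ite_existsUnique p h
  · simp [hP]

theorem isCostasArray_of_golomb {F : Type*} [Field F] [Fintype F] [DecidableEq F] {a b : F}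
    (ha : IsPrimitiveElt a) (hb : IsPrimitiveElt b) (hab : a + b = 1) (s : ℕ → ℕ → ℕ)
    (hs : ∀ i ∈ Finset.Icc 1 (Fintype.card F - 3), ∀ j ∈ Finset.Icc 1 (Fintype.card F - 3),
      s i j = if a ^ (i + 1) + b ^ (j + 1) = 1 then 1 else 0) :
    IsCostasArray (Fintype.card F - 3) s := by
  refine ⟨⟨fun i hi j hj => ?_, fun i hi => ?_, fun j hj => ?_⟩, ?_⟩
  · rw [hs i hi j hj]
    split_ifs <;> simp
  · rw [Finset.sum_congr rfl fun j hj => hs i hi j hj]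
    exact sum_ite_existsUnique _ (golomb_existsUnique ha hb hab hi)
  · rw [Finset.sum_congr rfl fun i hi => hs i hi j hj]
    refine sum_ite_existsUnique _ ?_
    simpa only [add_comm] using golomb_existsUnique hb ha ((add_comm b a).trans hab) hj
  · intro i1 hi1 j1 hj1 i2 hi2 j2 hj2 i3 hi3 j3 hj3 i4 hi4 j4 hj4 h1 h2 h3 h4 heq hne
    simp only [hs _ hi1 _ hj1, hs _ hi2 _ hj2, hs _ hi3 _ hj3, hs _ hi4 _ hj4,
      ite_eq_left_iff, zero_ne_one, imp_false, not_not] at h1 h2 h3 h4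
    have eq_of_left_eq : ∀ i ∈ Finset.Icc 1 (Fintype.card F - 3),
        ∀ j ∈ Finset.Icc 1 (Fintype.card F - 3), ∀ i' ∈ Finset.Icc 1 (Fintype.card F - 3),
        ∀ j' ∈ Finset.Icc 1 (Fintype.card F - 3), a ^ (i + 1) + b ^ (j + 1) = 1 →
        a ^ (i' + 1) + b ^ (j' + 1) = 1 → a ^ (i + 1) = a ^ (i' + 1) → i = i' ∧ j = j' := by
      intro i hi j hj i' hi' j' hj' h h' hpow
      rw [Finset.mem_Icc] at hi hj hi' hj'
      have hii := ha.pow_inj_s11 (by omega) (by omega) hpow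
      have hjj := hb.pow_inj_s11 (m := j + 1) (n := j' + 1) (by omega) (by omega)
        (by linear_combination h - h' - hpow)
      omega
    rw [Prod.mk.injEq] at heq
    have hx : a ^ (i2 + 1) * a ^ (i3 + 1) = a ^ (i1 + 1) * a ^ (i4 + 1) := by
      rw [← pow_add, ← pow_add]
      congr 1
      omega
    have hy : b ^ (j2 + 1) * b ^ (j3 + 1) = b ^ (j1 + 1) * b ^ (j4 + 1) := by
      rw [← pow_add, ← pow_add]
      congr 1
      omega
    have hprod : (a ^ (i1 + 1) - a ^ (i2 + 1)) * (a ^ (i1 + 1) - a ^ (i3 + 1)) = 0 := by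
      generalize a ^ (i1 + 1) = x1, a ^ (i2 + 1) = x2, a ^ (i3 + 1) = x3, a ^ (i4 + 1) = x4,
        b ^ (j1 + 1) = y1, b ^ (j2 + 1) = y2, b ^ (j3 + 1) = y3, b ^ (j4 + 1) = y4 at *
      obtain rfl : y1 = 1 - x1 := by linear_combination h1
      obtain rfl : y2 = 1 - x2 := by linear_combination h2
      obtain rfl : y3 = 1 - x3 := by linear_combination h3
      obtain rfl : y4 = 1 - x4 := by linear_combination h4
      linear_combination (1 - x1) * hx + x1 * hy
    rcases mul_eq_zero.mp hprod with h | h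
    · obtain ⟨rfl, rfl⟩ := eq_of_left_eq _ hi1 _ hj1 _ hi2 _ hj2 h1 h2 (sub_eq_zero.mp h)
      simp at hne
    · obtain ⟨rfl, rfl⟩ := eq_of_left_eq _ hi1 _ hj1 _ hi3 _ hj3 h1 h3 (sub_eq_zero.mp h)
      rfl

section Triples

variable {F : Type*} [Field F] {x y z : F}

theorem inv_add_inv_eq_one_of_add_eq_one (hx : x ≠ 0) (hy : y ≠ 0) (hz : z ≠ 0)
    (hxy : x + y = 1) (hxz : x⁻¹ + z = 1) : y⁻¹ + z⁻¹ = 1 := by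
  field_simp at hxz ⊢
  grind

theorem inv_add_eq_one_of_inv_add_inv_eq_one (hx : x ≠ 0) (hy : y ≠ 0) (hz : z ≠ 0)
    (hxy : x + y = 1) (hyz : y⁻¹ + z⁻¹ = 1) : x⁻¹ + z = 1 := by
  field_simp at hyz ⊢
  grind

end Triples

/-- Third Costas cube family: for a prime power `q > 3` and a primitive element `φ`
of `𝔽_q` with `1 − φ` and `1 − φ⁻¹` also primitive, the array
`d i j k = I[φ^(i+1) + (1−φ)^(j+1) = 1 ∧ φ^(−(i+1)) + (1−φ⁻¹)^(k+1) = 1 ∧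
(1−φ)^(−(j+1)) + (1−φ⁻¹)^(−(k+1)) = 1]` for `i, j, k ∈ {1, …, q−3}` is an order
`q − 3` Costas cube, whose Projection A is the `G₃(q, φ)` Golomb Costas array,
Projection B is the `G₃(q, φ⁻¹)` Golomb Costas array, and Projection C is the
`G₃(q, (1−φ)⁻¹)` Golomb Costas array. -/
theorem third_costas_cube_family (q : ℕ) (hq : 3 < q) (F : Type*) [Field F] [Fintype F]
    [DecidableEq F] (hcard : Fintype.card F = q) (φ : F)
    (hφ : IsPrimitiveElt φ) (hφ1 : IsPrimitiveElt (1 - φ))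
    (hφ2 : IsPrimitiveElt (1 - φ⁻¹))
    (d : ℕ → ℕ → ℕ → ℕ)
    (hd : d = fun (i j k : ℕ) =>
      if φ ^ (i + 1) + (1 - φ) ^ (j + 1) = 1 ∧
          φ ^ (-((i : ℤ) + 1)) + (1 - φ⁻¹) ^ (k + 1) = 1 ∧
          (1 - φ) ^ (-((j : ℤ) + 1)) + (1 - φ⁻¹) ^ (-((k : ℤ) + 1)) = 1
      then 1 else 0) :
    IsCostasCube (q - 3) d ∧
    (∀ i ∈ Finset.Icc 1 (q - 3), ∀ j ∈ Finset.Icc 1 (q - 3),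
      ProjA (q - 3) d i j =
        if φ ^ (i + 1) + (1 - φ) ^ (j + 1) = 1 then 1 else 0) ∧
    (∀ i ∈ Finset.Icc 1 (q - 3), ∀ k ∈ Finset.Icc 1 (q - 3),
      ProjB (q - 3) d i k =
        if (φ⁻¹) ^ (i + 1) + (1 - φ⁻¹) ^ (k + 1) = 1 then 1 else 0) ∧
    (∀ j ∈ Finset.Icc 1 (q - 3), ∀ k ∈ Finset.Icc 1 (q - 3),
      ProjC (q - 3) d j k =
        if ((1 - φ)⁻¹) ^ (j + 1) + (1 - (1 - φ)⁻¹) ^ (k + 1) = 1 then 1 else 0) := by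
  subst hcard
  have hφ0 : φ ≠ 0 := hφ.ne_zero_s11 hq
  have hβ0 : 1 - φ ≠ 0 := hφ1.ne_zero_s11 hq
  have hγ0 : 1 - φ⁻¹ ≠ 0 := hφ2.ne_zero_s11 hq
  have hγ : 1 - (1 - φ)⁻¹ = (1 - φ⁻¹)⁻¹ := by
    rw [sub_eq_iff_eq_add', eq_comm]
    exact inv_add_inv_eq_one_of_add_eq_one hφ0 hβ0 hγ0 (by ring) (by ring)
  have hd' : ∀ i j k, d i j k =
      if φ ^ (i + 1) + (1 - φ) ^ (j + 1) = 1 ∧ (φ⁻¹) ^ (i + 1) + (1 - φ⁻¹) ^ (k + 1) = 1 ∧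
        ((1 - φ)⁻¹) ^ (j + 1) + (1 - (1 - φ)⁻¹) ^ (k + 1) = 1 then 1 else 0 := by
    intro i j k
    have hzpow : ∀ (x : F) (n : ℕ), x ^ (-((n : ℤ) + 1)) = x⁻¹ ^ (n + 1) := fun x n => by
      rw [zpow_neg, inv_pow, ← zpow_natCast, Nat.cast_succ]
    simp only [hd, hzpow, hγ]
  have hinv : ∀ (i j k : ℕ), φ ^ (i + 1) + (1 - φ) ^ (j + 1) = 1 →
      ((φ⁻¹) ^ (i + 1) + (1 - φ⁻¹) ^ (k + 1) = 1 ↔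
        ((1 - φ)⁻¹) ^ (j + 1) + (1 - (1 - φ)⁻¹) ^ (k + 1) = 1) := by
    intro i j k h
    have hx := pow_ne_zero (i + 1) hφ0
    have hy := pow_ne_zero (j + 1) hβ0
    have hz := pow_ne_zero (k + 1) hγ0
    rw [hγ, inv_pow, inv_pow, inv_pow]
    exact ⟨inv_add_inv_eq_one_of_add_eq_one hx hy hz h,
      inv_add_eq_one_of_inv_add_inv_eq_one hx hy hz h⟩
  have hA : ∀ i ∈ Finset.Icc 1 (Fintype.card F - 3), ∀ j ∈ Finset.Icc 1 (Fintype.card F - 3),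
      ProjA (Fintype.card F - 3) d i j =
        if φ ^ (i + 1) + (1 - φ) ^ (j + 1) = 1 then 1 else 0 := by
    intro i hi j _
    rw [ProjA, ← sum_ite_and_existsUnique _ _
      (golomb_existsUnique hφ.inv hφ2 (add_sub_cancel _ _) hi)]
    refine Finset.sum_congr rfl fun k _ => ?_
    rw [hd']
    exact if_congr (by have := hinv i j k; tauto) rfl rfl
  have hB : ∀ i ∈ Finset.Icc 1 (Fintype.card F - 3), ∀ k ∈ Finset.Icc 1 (Fintype.card F - 3),
      ProjB (Fintype.card F - 3) d i k =
        if (φ⁻¹) ^ (i + 1) + (1 - φ⁻¹) ^ (k + 1) = 1 then 1 else 0 := by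
    intro i hi k _
    rw [ProjB, ← sum_ite_and_existsUnique _ _
      (golomb_existsUnique hφ hφ1 (add_sub_cancel _ _) hi)]
    refine Finset.sum_congr rfl fun j _ => ?_
    rw [hd']
    exact if_congr (by have := hinv i j k; tauto) rfl rfl
  have hC : ∀ j ∈ Finset.Icc 1 (Fintype.card F - 3), ∀ k ∈ Finset.Icc 1 (Fintype.card F - 3),
      ProjC (Fintype.card F - 3) d j k =
        if ((1 - φ)⁻¹) ^ (j + 1) + (1 - (1 - φ)⁻¹) ^ (k + 1) = 1 then 1 else 0 := by
    intro j hj k _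
    rw [ProjC, ← sum_ite_and_existsUnique _ _
      (golomb_existsUnique hφ1 hφ (sub_add_cancel _ _) hj)]
    refine Finset.sum_congr rfl fun i _ => ?_
    rw [hd', add_comm ((1 - φ) ^ (j + 1)) (φ ^ (i + 1))]
    exact if_congr (by have := hinv i j k; tauto) rfl rfl
  refine ⟨⟨fun i _ j _ k _ => ?_, isCostasArray_of_golomb hφ hφ1 (add_sub_cancel _ _) _ hA,
    isCostasArray_of_golomb hφ.inv hφ2 (add_sub_cancel _ _) _ hB,
    isCostasArray_of_golomb hφ1.inv (hγ ▸ hφ2.inv) (add_sub_cancel _ _) _ hC⟩, hA, hB, hC⟩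
  rw [hd']
  split_ifs <;> simp
end

section
/- Let D = (d_{i,j,k}) be an order n Costas cube. Then the vectors joining pairs of 1 entries of D are all distinct: whenever p1, p2, p3, p4 ∈ {1, …, n}^3 satisfy d_{p1} = d_{p2} = d_{p3} = d_{p4} = 1 and p2 − p1 = p4 − p3 ≠ (0,0,0), then p1 = p3. -/
/-- Each row of a permutation array holds at most one `1`. -/
theorem IsPermArray.col_unique {n : ℕ} {s : ℕ → ℕ → ℕ} (hs : IsPermArray n s) {i j j' : ℕ}
    (hi : i ∈ Finset.Icc 1 n) (hj : j ∈ Finset.Icc 1 n) (hj' : j' ∈ Finset.Icc 1 n)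
    (h : s i j = 1) (h' : s i j' = 1) : j = j' := by
  by_contra hne
  have hle := Finset.add_le_sum (f := s i) (fun _ _ => Nat.zero_le (s i _)) hj hj' hne
  have hsum := hs.2.1 i hi
  omega

/-- A sum that contains a `1` and takes only the values `0` and `1` equals `1`. -/
theorem sum_eq_one_of_eq_one {t : Finset ℕ} {f : ℕ → ℕ} {a : ℕ} (ha : a ∈ t) (hfa : f a = 1)
    (hsum : ∑ x ∈ t, f x = 0 ∨ ∑ x ∈ t, f x = 1) : ∑ x ∈ t, f x = 1 := by
  have hle := Finset.single_le_sum_of_canonicallyOrdered (f := f) ha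
  omega

/-- Each `1` entry of a Costas cube projects to a `1` entry of Projection A. -/
theorem IsCostasCube.projA_eq_one {n : ℕ} {d : ℕ → ℕ → ℕ → ℕ} (hD : IsCostasCube n d)
    {i j k : ℕ} (hi : i ∈ Finset.Icc 1 n) (hj : j ∈ Finset.Icc 1 n) (hk : k ∈ Finset.Icc 1 n)
    (h : d i j k = 1) : ProjA n d i j = 1 :=
  sum_eq_one_of_eq_one (f := fun k => d i j k) hk h (hD.2.1.1.1 i hi j hj)

/-- Each `1` entry of a Costas cube projects to a `1` entry of Projection B. -/
theorem IsCostasCube.projB_eq_one {n : ℕ} {d : ℕ → ℕ → ℕ → ℕ} (hD : IsCostasCube n d)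
    {i j k : ℕ} (hi : i ∈ Finset.Icc 1 n) (hj : j ∈ Finset.Icc 1 n) (hk : k ∈ Finset.Icc 1 n)
    (h : d i j k = 1) : ProjB n d i k = 1 :=
  sum_eq_one_of_eq_one (f := fun j => d i j k) hj h (hD.2.2.1.1.1 i hi k hk)

/-- The first coordinate of a `1` entry of a Costas cube determines the third. -/
theorem IsCostasCube.third_unique {n : ℕ} {d : ℕ → ℕ → ℕ → ℕ} (hD : IsCostasCube n d)
    {i j k j' k' : ℕ} (hi : i ∈ Finset.Icc 1 n) (hj : j ∈ Finset.Icc 1 n)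
    (hk : k ∈ Finset.Icc 1 n) (hj' : j' ∈ Finset.Icc 1 n) (hk' : k' ∈ Finset.Icc 1 n)
    (h : d i j k = 1) (h' : d i j' k' = 1) : k = k' :=
  hD.2.2.1.1.col_unique hi hk hk' (hD.projB_eq_one hi hj hk h) (hD.projB_eq_one hi hj' hk' h')

/-- In an order `n` Costas cube, the vectors joining pairs of `1` entries are all
distinct. -/
theorem costas_cube_distinct_vectors (n : ℕ) (d : ℕ → ℕ → ℕ → ℕ)
    (hD : IsCostasCube n d) :
    ∀ i1 ∈ Finset.Icc 1 n, ∀ j1 ∈ Finset.Icc 1 n, ∀ k1 ∈ Finset.Icc 1 n,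
    ∀ i2 ∈ Finset.Icc 1 n, ∀ j2 ∈ Finset.Icc 1 n, ∀ k2 ∈ Finset.Icc 1 n,
    ∀ i3 ∈ Finset.Icc 1 n, ∀ j3 ∈ Finset.Icc 1 n, ∀ k3 ∈ Finset.Icc 1 n,
    ∀ i4 ∈ Finset.Icc 1 n, ∀ j4 ∈ Finset.Icc 1 n, ∀ k4 ∈ Finset.Icc 1 n,
      d i1 j1 k1 = 1 → d i2 j2 k2 = 1 → d i3 j3 k3 = 1 → d i4 j4 k4 = 1 →
      ((i2 : ℤ) - (i1 : ℤ), (j2 : ℤ) - (j1 : ℤ), (k2 : ℤ) - (k1 : ℤ)) =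
        ((i4 : ℤ) - (i3 : ℤ), (j4 : ℤ) - (j3 : ℤ), (k4 : ℤ) - (k3 : ℤ)) →
      ((i2 : ℤ) - (i1 : ℤ), (j2 : ℤ) - (j1 : ℤ), (k2 : ℤ) - (k1 : ℤ)) ≠ (0, 0, 0) →
      (i1, j1, k1) = (i3, j3, k3) := by
  intro i1 hi1 j1 hj1 k1 hk1 i2 hi2 j2 hj2 k2 hk2 i3 hi3 j3 hj3 k3 hk3 i4 hi4 j4 hj4 k4 hk4
    h1 h2 h3 h4 hvec hne
  simp only [Prod.mk.injEq] at hvec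
  have hne' : ((i2 : ℤ) - (i1 : ℤ), (j2 : ℤ) - (j1 : ℤ)) ≠ (0, 0) := by
    intro h0
    simp only [Prod.mk.injEq] at h0
    obtain rfl : i1 = i2 := by omega
    obtain rfl := hD.third_unique hi1 hj1 hk1 hj2 hk2 h1 h2
    exact hne (by simp [h0.2])
  have hA := hD.2.1.2 i1 hi1 j1 hj1 i2 hi2 j2 hj2 i3 hi3 j3 hj3 i4 hi4 j4 hj4
    (hD.projA_eq_one hi1 hj1 hk1 h1) (hD.projA_eq_one hi2 hj2 hk2 h2)
    (hD.projA_eq_one hi3 hj3 hk3 h3) (hD.projA_eq_one hi4 hj4 hk4 h4)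
    (Prod.ext hvec.1 hvec.2.1) hne'
  obtain ⟨rfl, rfl⟩ := Prod.mk.inj hA
  rw [hD.third_unique hi1 hj1 hk1 hj3 hk3 h1 h3]
end
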